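/- Let (X,π) be a totally connected pure d-dimensional weighted simplicial complex with d ≥ 2, and let 0 < δ ≤ 1. If γ_2 ≤ (1−δ)/d, then for every 2 ≤ k ≤ d we have γ_k ≤ (1−δ)/(d−(k−2)(1−δ)), and consequently γ_k ≤ (1−δ)/(dδ). -/

import Mathlib

open Finset in
/-- A pure `d`-dimensional weighted simplicial complex, given by its facets (all of
cardinality `d+1`) together with a full-support probability distribution `pi` on the facets.
The faces of the complex are all subsets of facets. -/
structure WeightedComplex (V : Type*) [Fintype V] [DecidableEq V] (d : ℕ) where
  facets : Finset (Finset V)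
  facets_nonempty : facets.Nonempty
  pure : ∀ τ ∈ facets, τ.card = d + 1
  pi : Finset V → ℝ
  pi_pos : ∀ τ ∈ facets, 0 < pi τ
  pi_eq_zero : ∀ τ, τ ∉ facets → pi τ = 0
  pi_sum_one : ∑ τ ∈ facets, pi τ = 1

namespace WeightedComplex

variable {V : Type*} [Fintype V] [DecidableEq V] {d : ℕ}

/-- `σ` is a face of the complex (a subset of some facet). -/
def IsFace (K : WeightedComplex V d) (σ : Finset V) : Prop :=
  ∃ η ∈ K.facets, σ ⊆ η

/-- Total `π`-weight of the facets containing `τ`. -/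
noncomputable def faceWeight (K : WeightedComplex V d) (τ : Finset V) : ℝ :=
  ∑ η ∈ K.facets.filter (fun η => τ ⊆ η), K.pi η

/-- `Pr_{σ ∼ π_τ}[{x,y} ⊆ σ]`: the weight of the edge `{x,y}` in the 1-skeleton of the
link of `τ`. -/
noncomputable def linkWeight (K : WeightedComplex V d) (τ : Finset V) (x y : V) : ℝ :=
  if x = y ∨ x ∈ τ ∨ y ∈ τ then 0
  else (∑ η ∈ K.facets.filter (fun η => τ ⊆ η ∧ x ∈ η ∧ y ∈ η), K.pi η) / K.faceWeight τ

/-- The transition probability matrix `P_τ` of the simple random walk on the 1-skeleton of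
the link `(X_τ, π_τ)`, padded with zeros outside the `X_τ(0) × X_τ(0)` block. -/
noncomputable def walkMatrix (K : WeightedComplex V d) (τ : Finset V) : Matrix V V ℝ :=
  Matrix.of fun x y => K.linkWeight τ x y / ∑ z, K.linkWeight τ x z

/-- `Pr_{σ ∼ π_τ}[x ∈ σ]`. -/
noncomputable def probMem (K : WeightedComplex V d) (τ : Finset V) (x : V) : ℝ :=
  if x ∈ τ then 0 else K.faceWeight (insert x τ) / K.faceWeight τ

/-- The vertex marginal `π_{τ,0}(x) = Pr_{σ∼π_τ}[x ∈ σ] / codim(τ)`, viewed as a vector on all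
of `V` (zero outside `X_τ(0)`). -/
noncomputable def vertexMarginal (K : WeightedComplex V d) (τ : Finset V) (x : V) : ℝ :=
  ((d + 1 - τ.card : ℕ) : ℝ)⁻¹ * K.probMem τ x

/-- The facets of the link `X_τ`. -/
def linkFacets (K : WeightedComplex V d) (τ : Finset V) : Finset (Finset V) :=
  (K.facets.filter (fun η => τ ⊆ η)).image (fun η => η \ τ)

/-- The facet distribution `π_τ` of the link of `τ`. -/
noncomputable def linkPi (K : WeightedComplex V d) (τ : Finset V) (σ : Finset V) : ℝ :=
  K.pi (σ ∪ τ) / K.faceWeight τ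

/-- The 1-skeleton of the link of every face of co-dimension at least 2 is connected. -/
def TotallyConnected (K : WeightedComplex V d) : Prop :=
  ∀ τ : Finset V, K.IsFace τ → τ.card + 2 ≤ d + 1 →
    ∀ x y : V, x ∉ τ → K.IsFace (insert x τ) → y ∉ τ → K.IsFace (insert y τ) →
      Relation.ReflTransGen (fun a b => 0 < K.linkWeight τ a b) x y

end WeightedComplex

/-- The second largest eigenvalue of a random-walk transition matrix `P`: the largest point of
the real spectrum of `P` lying below the trivial top eigenvalue `1`. -/
noncomputable def lambda2 {n : Type*} [Fintype n] [DecidableEq n] (P : Matrix n n ℝ) : ℝ :=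
  sSup {μ : ℝ | μ < 1 ∧ μ ∈ spectrum ℝ P}

open Matrix in
/-- If a vector `h` is orthogonal to every eigenvector of a real symmetric matrix whose eigenvalue
exceeds `γ`, then the Rayleigh quotient of `h` is at most `γ`. -/
theorem Matrix.IsHermitian.dotProduct_mulVec_le_of_orthogonal {n : Type*} [Fintype n]
    [DecidableEq n] {S : Matrix n n ℝ} (hS : S.IsHermitian) {γ : ℝ} {h : n → ℝ}
    (horth : ∀ (v : n → ℝ) (μ : ℝ), S *ᵥ v = μ • v → γ < μ → v ⬝ᵥ h = 0) :
    h ⬝ᵥ (S *ᵥ h) ≤ γ * (h ⬝ᵥ h) := by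
  set b := hS.eigenvectorBasis
  set μ := hS.eigenvalues
  set c : n → ℝ := fun i => (b i).ofLp ⬝ᵥ h with hc
  have hSv (i : n) : S *ᵥ (b i).ofLp = μ i • (b i).ofLp := hS.mulVec_eigenvectorBasis i
  have expand (u : n → ℝ) : ∑ i, c i * ((b i).ofLp ⬝ᵥ u) = h ⬝ᵥ u := by
    have := b.sum_inner_mul_inner (WithLp.toLp 2 h) (WithLp.toLp 2 u)
    simp only [EuclideanSpace.inner_eq_star_dotProduct, star_trivial] at this
    rw [dotProduct_comm h u, ← this]
    exact Finset.sum_congr rfl fun i _ => by rw [dotProduct_comm u]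
  have hSc (i : n) : (b i).ofLp ⬝ᵥ (S *ᵥ h) = μ i * c i := by
    have hT : Sᵀ = S := by simpa [conjTranspose_eq_transpose_of_trivial] using hS.eq
    rw [dotProduct_mulVec, ← mulVec_transpose, hT, hSv, smul_dotProduct, smul_eq_mul]
  rw [← expand, ← expand, Finset.mul_sum]
  refine Finset.sum_le_sum fun i _ => ?_
  rw [hSc]
  rcases lt_or_ge γ (μ i) with hlt | hle
  · simp [hc, horth _ _ (hSv i) hlt]
  · nlinarith [mul_le_mul_of_nonneg_right hle (mul_self_nonneg (c i))]

theorem Matrix.mem_spectrum_iff_exists_mulVec {n : Type*} [Fintype n] [DecidableEq n]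
    {P : Matrix n n ℝ} {μ : ℝ} :
    μ ∈ spectrum ℝ P ↔ ∃ v : n → ℝ, v ≠ 0 ∧ P.mulVec v = μ • v := by
  rw [← Matrix.spectrum_toLin', ← Module.End.hasEigenvalue_iff_mem_spectrum]
  constructor
  · intro h
    obtain ⟨v, hv⟩ := h.exists_hasEigenvector
    exact ⟨v, hv.2, by simpa using hv.apply_eq_smul⟩
  · rintro ⟨v, hv0, hv⟩
    exact Module.End.hasEigenvalue_of_hasEigenvector
      (Module.End.hasEigenvector_iff.2 ⟨Module.End.mem_eigenspace_iff.2 (by simpa using hv), hv0⟩)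

section WeightedGraph

variable {V : Type*} [Fintype V] {W : V → V → ℝ}

/-- The Dirichlet form of a symmetric weight function. -/
theorem sum_sum_mul_sub_sq (hsymm : ∀ x y, W x y = W y x) (u : V → ℝ) :
    ∑ x, ∑ y, W x y * (u x - u y) ^ 2 =
      2 * (∑ x, (∑ z, W x z) * u x ^ 2) - 2 * ∑ x, ∑ y, W x y * u x * u y := by
  have h1 : ∑ x, ∑ y, W x y * u y ^ 2 = ∑ x, (∑ z, W x z) * u x ^ 2 := by
    rw [Finset.sum_comm]
    simp only [Finset.sum_mul]
    exact Finset.sum_congr rfl fun x _ => Finset.sum_congr rfl fun y _ => by rw [hsymm]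
  have h2 : ∑ x, ∑ y, W x y * u x ^ 2 = ∑ x, (∑ z, W x z) * u x ^ 2 := by
    simp only [Finset.sum_mul]
  calc _ = ∑ x, ∑ y, (W x y * u x ^ 2 + W x y * u y ^ 2 - 2 * (W x y * u x * u y)) :=
        Finset.sum_congr rfl fun x _ => Finset.sum_congr rfl fun y _ => by ring
    _ = _ := by
        simp only [Finset.sum_sub_distrib, Finset.sum_add_distrib, ← Finset.mul_sum, h1, h2]
        ring

/-- In a connected weighted graph, a function satisfying `W u = μ D u` with `1 ≤ μ` is constant on
the vertices of positive degree. -/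
theorem eq_of_one_le_eigenvalue (hsymm : ∀ x y, W x y = W y x) (hnonneg : ∀ x y, 0 ≤ W x y)
    (hconn : ∀ x y, 0 < ∑ z, W x z → 0 < ∑ z, W y z →
      Relation.ReflTransGen (fun a b => 0 < W a b) x y)
    {u : V → ℝ} {μ : ℝ} (hμ : 1 ≤ μ)
    (hu : ∀ x, ∑ y, W x y * u y = μ * ((∑ z, W x z) * u x))
    {x y : V} (hx : 0 < ∑ z, W x z) (hy : 0 < ∑ z, W y z) : u x = u y := by
  have hform : ∑ x, ∑ y, W x y * u x * u y = μ * ∑ x, (∑ z, W x z) * u x ^ 2 := by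
    rw [Finset.mul_sum]
    refine Finset.sum_congr rfl fun x _ => ?_
    calc _ = u x * ∑ y, W x y * u y := by
          rw [Finset.mul_sum]; exact Finset.sum_congr rfl fun y _ => by ring
      _ = _ := by rw [hu]; ring
  have hN : 0 ≤ ∑ x, (∑ z, W x z) * u x ^ 2 :=
    Finset.sum_nonneg fun x _ =>
      mul_nonneg (Finset.sum_nonneg fun z _ => hnonneg x z) (sq_nonneg _)
  have hterm (a b : V) : 0 ≤ W a b * (u a - u b) ^ 2 := mul_nonneg (hnonneg a b) (sq_nonneg _)
  have hzero : ∑ x, ∑ y, W x y * (u x - u y) ^ 2 = 0 := by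
    refine le_antisymm ?_ (Finset.sum_nonneg fun a _ => Finset.sum_nonneg fun b _ => hterm a b)
    rw [sum_sum_mul_sub_sq hsymm, hform]
    nlinarith
  have hedge (a b : V) (hab : 0 < W a b) : u a = u b := by
    have h1 := (Finset.sum_eq_zero_iff_of_nonneg fun a _ =>
      Finset.sum_nonneg fun b _ => hterm a b).1 hzero a (Finset.mem_univ a)
    have h2 := (Finset.sum_eq_zero_iff_of_nonneg fun b _ => hterm a b).1 h1 b (Finset.mem_univ b)
    rcases mul_eq_zero.1 h2 with h | h
    · exact absurd h hab.ne'
    · exact sub_eq_zero.1 (pow_eq_zero_iff two_ne_zero |>.1 h)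
  have hpath (b : V) (hxb : Relation.ReflTransGen (fun a b => 0 < W a b) x b) : u x = u b := by
    induction hxb with
    | refl => rfl
    | tail _ hab ih => exact ih.trans (hedge _ _ hab)
  exact hpath y (hconn x y hx hy)

/-- In a connected weighted graph whose walk matrix has all eigenvalues other than the trivial one
at most `γ`, functions orthogonal to the constants have Rayleigh quotient at most `γ`. -/
theorem sum_sum_le_of_spectrum_le_of_sum_eq_zero [DecidableEq V]
    (hsymm : ∀ x y, W x y = W y x) (hnonneg : ∀ x y, 0 ≤ W x y)
    (hconn : ∀ x y, 0 < ∑ z, W x z → 0 < ∑ z, W y z →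
      Relation.ReflTransGen (fun a b => 0 < W a b) x y)
    {γ : ℝ} (hγ : ∀ μ ∈ spectrum ℝ (Matrix.of fun x y => W x y / ∑ z, W x z), μ < 1 → μ ≤ γ)
    {g : V → ℝ} (hg : ∑ x, (∑ z, W x z) * g x = 0) :
    ∑ x, ∑ y, W x y * g x * g y ≤ γ * ∑ x, (∑ z, W x z) * g x ^ 2 := by
  set D : V → ℝ := fun x => ∑ z, W x z with hD
  have hD0 (x : V) : 0 ≤ D x := Finset.sum_nonneg fun z _ => hnonneg x z
  have hsq (x : V) : √(D x) * √(D x) = D x := Real.mul_self_sqrt (hD0 x)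
  have hW0 {x : V} (hx : D x = 0) (y : V) : W x y = 0 :=
    (Finset.sum_eq_zero_iff_of_nonneg fun z _ => hnonneg x z).1 hx y (Finset.mem_univ y)
  have hsqrt_ne {x : V} (hx : D x ≠ 0) : √(D x) ≠ 0 := (Real.sqrt_ne_zero (hD0 x)).2 hx
  set S : Matrix V V ℝ := Matrix.of fun x y => W x y / (√(D x) * √(D y)) with hSdef
  have hS : S.IsHermitian := by
    ext x y
    simp [hSdef, hsymm x y, mul_comm]
  set h : V → ℝ := fun x => √(D x) * g x with hh
  have hhh : h ⬝ᵥ h = ∑ x, D x * g x ^ 2 :=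
    Finset.sum_congr rfl fun x _ => by rw [← hsq x]; ring
  have hhS : h ⬝ᵥ S.mulVec h = ∑ x, ∑ y, W x y * g x * g y := by
    simp only [dotProduct, Matrix.mulVec, Finset.mul_sum]
    refine Finset.sum_congr rfl fun x _ => Finset.sum_congr rfl fun y _ => ?_
    simp only [hSdef, hh, Matrix.of_apply]
    by_cases hx : D x = 0
    · simp [hW0 hx y]
    by_cases hy : D y = 0
    · simp [hsymm x y, hW0 hy x]
    have := hsqrt_ne hx
    have := hsqrt_ne hy
    field_simp
  rw [← hhS, ← hhh]
  refine hS.dotProduct_mulVec_le_of_orthogonal fun v μ hv hμ => ?_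
  set u : V → ℝ := fun x => v x / √(D x) with hu
  have hDu (x : V) : D x * u x = √(D x) * v x := by
    by_cases hx : D x = 0
    · simp [hx]
    · calc D x * u x = √(D x) * √(D x) * u x := by rw [hsq]
        _ = √(D x) * v x := by rw [mul_assoc, mul_div_cancel₀ _ (hsqrt_ne hx)]
  have hvh : v ⬝ᵥ h = ∑ x, D x * g x * u x :=
    Finset.sum_congr rfl fun x _ => by rw [mul_right_comm, hDu, hh]; ring
  have heig (x : V) : ∑ y, W x y * u y = μ * (D x * u x) := by
    by_cases hx : D x = 0
    · simp [hW0 hx, hx]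
    have hx' := hsqrt_ne hx
    have hvx : ∑ y, W x y / (√(D x) * √(D y)) * v y = μ * v x := congrFun hv x
    calc ∑ y, W x y * u y = √(D x) * ∑ y, W x y / (√(D x) * √(D y)) * v y := by
          rw [Finset.mul_sum]
          refine Finset.sum_congr rfl fun y _ => ?_
          simp only [hu]
          field_simp
      _ = μ * (D x * u x) := by
          rw [hvx, hDu]; ring
  rw [hvh]
  by_cases hu0 : u = 0
  · simp [hu0]
  have hspec : μ ∈ spectrum ℝ (Matrix.of fun x y => W x y / ∑ z, W x z) := by
    refine Matrix.mem_spectrum_iff_exists_mulVec.2 ⟨u, hu0, funext fun x => ?_⟩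
    change ∑ y, W x y / D x * u y = μ * u x
    by_cases hx : D x = 0
    · simp [hu, hx]
    · calc ∑ y, W x y / D x * u y = (∑ y, W x y * u y) / D x := by
            rw [Finset.sum_div]; exact Finset.sum_congr rfl fun y _ => by ring
        _ = μ * u x := by rw [heig]; field_simp
  have hμ1 : 1 ≤ μ := not_lt.1 fun hlt => hμ.not_ge (hγ μ hspec hlt)
  by_cases hex : ∃ x, D x ≠ 0
  · obtain ⟨a, ha⟩ := hex
    calc ∑ x, D x * g x * u x = (∑ x, D x * g x) * u a := by
          rw [Finset.sum_mul]
          refine Finset.sum_congr rfl fun x _ => ?_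
          by_cases hx : D x = 0
          · simp [hx]
          · rw [eq_of_one_le_eigenvalue hsymm hnonneg hconn hμ1 heig
              ((hD0 x).lt_of_ne' hx) ((hD0 a).lt_of_ne' ha)]
      _ = 0 := by rw [hg, zero_mul]
  · push Not at hex
    simp [hex]

/-- The Rayleigh bound for arbitrary functions, with the contribution of the mean separated. -/
theorem sum_sum_le_of_spectrum_le [DecidableEq V]
    (hsymm : ∀ x y, W x y = W y x) (hnonneg : ∀ x y, 0 ≤ W x y)
    (hconn : ∀ x y, 0 < ∑ z, W x z → 0 < ∑ z, W y z →
      Relation.ReflTransGen (fun a b => 0 < W a b) x y)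
    {γ : ℝ} (hγ : ∀ μ ∈ spectrum ℝ (Matrix.of fun x y => W x y / ∑ z, W x z), μ < 1 → μ ≤ γ)
    (f : V → ℝ) :
    ∑ x, ∑ y, W x y * f x * f y ≤ γ * (∑ x, (∑ z, W x z) * f x ^ 2) +
      (1 - γ) * ((∑ x, (∑ z, W x z) * f x) ^ 2 / ∑ x, ∑ z, W x z) := by
  set D : V → ℝ := fun x => ∑ z, W x z with hD
  by_cases hT : ∑ x, D x = 0
  · have hDx (x : V) : D x = 0 := (Finset.sum_eq_zero_iff_of_nonneg fun x _ =>
      Finset.sum_nonneg fun z _ => hnonneg x z).1 hT x (Finset.mem_univ x)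
    have hW (x y : V) : W x y = 0 := (Finset.sum_eq_zero_iff_of_nonneg fun z _ =>
      hnonneg x z).1 (hDx x) y (Finset.mem_univ y)
    simp [hW, hDx]
  set T := ∑ x, D x with hTdef
  set A := ∑ x, D x * f x with hA
  set m := A / T with hm
  have hmT : m * T = A := div_mul_cancel₀ _ hT
  have h0 : ∑ x, D x * (f x - m) = 0 := by
    simp only [mul_sub, Finset.sum_sub_distrib, ← Finset.sum_mul]
    linarith
  have key := sum_sum_le_of_spectrum_le_of_sum_eq_zero hsymm hnonneg hconn hγ h0
  have hWr : ∑ x, ∑ y, W x y * f x = A :=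
    Finset.sum_congr rfl fun x _ => by rw [← Finset.sum_mul]
  have hWc : ∑ x, ∑ y, W x y * f y = A := by
    rw [Finset.sum_comm, ← hWr]
    exact Finset.sum_congr rfl fun x _ => Finset.sum_congr rfl fun y _ => by rw [hsymm]
  have e1 : ∑ x, ∑ y, W x y * (f x - m) * (f y - m) =
      ∑ x, ∑ y, W x y * f x * f y - m * A - m * A + m ^ 2 * T := by
    calc _ = ∑ x, ∑ y, (W x y * f x * f y - m * (W x y * f x) - m * (W x y * f y) +
          m ^ 2 * W x y) :=
          Finset.sum_congr rfl fun x _ => Finset.sum_congr rfl fun y _ => by ring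
      _ = _ := by
          simp only [Finset.sum_sub_distrib, Finset.sum_add_distrib, ← Finset.mul_sum, hWr, hWc]
          rfl
  have e2 : ∑ x, D x * (f x - m) ^ 2 = ∑ x, D x * f x ^ 2 - 2 * m * A + m ^ 2 * T := by
    calc _ = ∑ x, (D x * f x ^ 2 - 2 * m * (D x * f x) + m ^ 2 * D x) :=
          Finset.sum_congr rfl fun x _ => by ring
      _ = _ := by
          simp only [Finset.sum_sub_distrib, Finset.sum_add_distrib, ← Finset.mul_sum]
          rfl
  have e3 : A ^ 2 / T = m ^ 2 * T := by rw [hm]; field_simp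
  rw [e1] at key
  change _ ≤ γ * ∑ x, D x * (f x - m) ^ 2 at key
  rw [e2, ← hmT] at key
  rw [e3]
  linarith

end WeightedGraph

theorem le_lambda2 {n : Type*} [Fintype n] [DecidableEq n] {P : Matrix n n ℝ} {μ : ℝ}
    (hμ : μ ∈ spectrum ℝ P) (h1 : μ < 1) : μ ≤ lambda2 P :=
  le_csSup ⟨1, fun _ h => h.1.le⟩ ⟨h1, hμ⟩

theorem lambda2_le {n : Type*} [Fintype n] [DecidableEq n] {P : Matrix n n ℝ} {c : ℝ}
    (hc : 0 ≤ c) (h : ∀ μ ∈ spectrum ℝ P, μ < 1 → μ ≤ c) : lambda2 P ≤ c :=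
  Real.sSup_le (fun μ hμ => h μ hμ.2 hμ.1) hc

namespace WeightedComplex

variable {V : Type*} [Fintype V] [DecidableEq V] {d : ℕ} (K : WeightedComplex V d)

/-- The total weight of the facets containing `x` and `τ`, for `x` outside `τ`. -/
noncomputable def vertexWeight (τ : Finset V) (x : V) : ℝ :=
  if x ∈ τ then 0 else K.faceWeight (insert x τ)

/-- The total weight of the facets containing `x`, `y` and `τ`, for distinct `x`, `y` outside
`τ`. -/
noncomputable def edgeWeight (τ : Finset V) (x y : V) : ℝ :=
  if x ∈ τ then 0 else K.vertexWeight (insert x τ) y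

/-- The total weight of the facets containing `x`, `y`, `z` and `τ`, for distinct `x`, `y`, `z`
outside `τ`. -/
noncomputable def triangleWeight (τ : Finset V) (x y z : V) : ℝ :=
  if x ∈ τ then 0 else K.edgeWeight (insert x τ) y z

theorem faceWeight_nonneg (τ : Finset V) : 0 ≤ K.faceWeight τ :=
  Finset.sum_nonneg fun η hη => (K.pi_pos η (Finset.mem_filter.1 hη).1).le

theorem faceWeight_pos_iff {τ : Finset V} : 0 < K.faceWeight τ ↔ K.IsFace τ := by
  constructor
  · intro h
    obtain ⟨η, hη, -⟩ := Finset.exists_ne_zero_of_sum_ne_zero h.ne'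
    exact ⟨η, Finset.mem_filter.1 hη⟩
  · rintro ⟨η, hη, hτ⟩
    exact Finset.sum_pos (fun η hη => K.pi_pos η (Finset.mem_filter.1 hη).1)
      ⟨η, Finset.mem_filter.2 ⟨hη, hτ⟩⟩

theorem vertexWeight_nonneg (τ : Finset V) (x : V) : 0 ≤ K.vertexWeight τ x := by
  unfold vertexWeight
  split_ifs
  exacts [le_rfl, K.faceWeight_nonneg _]

theorem edgeWeight_nonneg (τ : Finset V) (x y : V) : 0 ≤ K.edgeWeight τ x y := by
  unfold edgeWeight
  split_ifs
  exacts [le_rfl, K.vertexWeight_nonneg _ _]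

theorem edgeWeight_comm (τ : Finset V) (x y : V) : K.edgeWeight τ x y = K.edgeWeight τ y x := by
  simp only [edgeWeight, vertexWeight, Finset.mem_insert, Finset.insert_comm x y]
  grind

theorem triangleWeight_rotate (τ : Finset V) (x y z : V) :
    K.triangleWeight τ x y z = K.triangleWeight τ y z x := by
  have h : insert z (insert y (insert x τ)) = insert x (insert z (insert y τ)) := by
    ext; simp; tauto
  simp only [triangleWeight, edgeWeight, vertexWeight, Finset.mem_insert, h]
  grind

theorem sum_vertexWeight (τ : Finset V) :
    ∑ x, K.vertexWeight τ x = ((d : ℝ) + 1 - τ.card) * K.faceWeight τ := by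
  have hv (x : V) : K.vertexWeight τ x =
      ∑ η ∈ K.facets.filter (fun η => τ ⊆ η), if x ∈ η \ τ then K.pi η else 0 := by
    unfold vertexWeight faceWeight
    rw [← Finset.sum_filter, Finset.filter_filter]
    split_ifs with hx
    · simp [hx]
    · refine Finset.sum_congr (Finset.filter_congr fun η _ => ?_) fun _ _ => rfl
      simp [Finset.insert_subset_iff, hx, and_comm]
  simp only [hv]
  rw [Finset.sum_comm, faceWeight, Finset.mul_sum]
  refine Finset.sum_congr rfl fun η hη => ?_
  obtain ⟨hη, hτ⟩ := Finset.mem_filter.1 hη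
  rw [← Finset.sum_filter, Finset.sum_const, nsmul_eq_mul, Finset.filter_univ_mem,
    Finset.cast_card_sdiff hτ, K.pure η hη]
  push_cast
  ring

theorem sum_edgeWeight (τ : Finset V) (x : V) :
    ∑ y, K.edgeWeight τ x y = ((d : ℝ) - τ.card) * K.vertexWeight τ x := by
  unfold edgeWeight
  split_ifs with hx
  · simp [vertexWeight, hx]
  · rw [sum_vertexWeight, vertexWeight, if_neg hx, Finset.card_insert_of_notMem hx]
    push_cast
    ring

theorem sum_triangleWeight (τ : Finset V) (x y : V) :
    ∑ z, K.triangleWeight τ x y z = ((d : ℝ) - τ.card - 1) * K.edgeWeight τ x y := by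
  unfold triangleWeight
  split_ifs with hx
  · simp [edgeWeight, hx]
  · rw [sum_edgeWeight, edgeWeight, if_neg hx, Finset.card_insert_of_notMem hx]
    push_cast
    ring

theorem linkWeight_eq (τ : Finset V) (x y : V) :
    K.linkWeight τ x y = K.edgeWeight τ x y / K.faceWeight τ := by
  unfold linkWeight
  split_ifs with h
  · have : K.edgeWeight τ x y = 0 := by
      simp only [edgeWeight, vertexWeight, Finset.mem_insert]
      grind
    simp [this]
  · push Not at h
    obtain ⟨hxy, hx, hy⟩ := h
    congr 1
    rw [edgeWeight, if_neg hx, vertexWeight, if_neg (by simp [hxy.symm, hy]), faceWeight]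
    refine Finset.sum_congr (Finset.filter_congr fun η _ => ?_) fun _ _ => rfl
    simp only [Finset.insert_subset_iff]
    tauto

theorem walkMatrix_eq {τ : Finset V} (hτ : K.IsFace τ) :
    K.walkMatrix τ = Matrix.of fun x y => K.edgeWeight τ x y / ∑ z, K.edgeWeight τ x z := by
  have := (K.faceWeight_pos_iff.2 hτ).ne'
  ext x y
  simp only [walkMatrix, linkWeight_eq, Matrix.of_apply, ← Finset.sum_div]
  rw [div_div_div_cancel_right₀ this]

theorem TotallyConnected.reflTransGen_edgeWeight {K : WeightedComplex V d} (hK : K.TotallyConnected)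
    {τ : Finset V} (hτ : K.IsFace τ) (hcard : τ.card + 2 ≤ d + 1) (x y : V)
    (hx : 0 < ∑ z, K.edgeWeight τ x z) (hy : 0 < ∑ z, K.edgeWeight τ y z) :
    Relation.ReflTransGen (fun a b => 0 < K.edgeWeight τ a b) x y := by
  have hvertex (a : V) (ha : 0 < ∑ z, K.edgeWeight τ a z) :
      a ∉ τ ∧ K.IsFace (insert a τ) := by
    rw [sum_edgeWeight, vertexWeight] at ha
    split_ifs at ha with haτ
    · simp at ha
    · exact ⟨haτ, K.faceWeight_pos_iff.1 ((K.faceWeight_nonneg _).lt_of_ne'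
        (right_ne_zero_of_mul ha.ne'))⟩
  have := hK τ hτ hcard x y (hvertex x hx).1 (hvertex x hx).2 (hvertex y hy).1 (hvertex y hy).2
  simpa only [linkWeight_eq, div_pos_iff_of_pos_right (K.faceWeight_pos_iff.2 hτ)] using this

/-- The Rayleigh bound in the link of `insert x τ`, in terms of the weights of the link of `τ`. -/
theorem TotallyConnected.sum_triangleWeight_le {K : WeightedComplex V d}
    (hK : K.TotallyConnected) {τ : Finset V} (hcard : τ.card + 3 ≤ d + 1) {γ : ℝ}
    (hγ : ∀ x, x ∉ τ → K.IsFace (insert x τ) → lambda2 (K.walkMatrix (insert x τ)) ≤ γ)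
    (f : V → ℝ) (x : V) :
    ∑ y, ∑ z, K.triangleWeight τ x y z * f y * f z ≤
      ((d : ℝ) - τ.card - 1) * (γ * (∑ y, K.edgeWeight τ x y * f y ^ 2) +
        (1 - γ) * ((∑ y, K.edgeWeight τ x y * f y) ^ 2 / ∑ y, K.edgeWeight τ x y)) := by
  by_cases hx : x ∈ τ
  · simp [triangleWeight, edgeWeight, hx]
  by_cases hface : K.IsFace (insert x τ)
  · have hcard' : (insert x τ).card = τ.card + 1 := Finset.card_insert_of_notMem hx
    have key := sum_sum_le_of_spectrum_le (K.edgeWeight_comm (insert x τ))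
      (K.edgeWeight_nonneg (insert x τ)) (hK.reflTransGen_edgeWeight hface (by omega))
      (fun μ hμ h1 => (le_lambda2 (K.walkMatrix_eq hface ▸ hμ) h1).trans (hγ x hx hface)) f
    have ht (y z : V) : K.edgeWeight (insert x τ) y z = K.triangleWeight τ x y z := by
      rw [triangleWeight, if_neg hx]
    have hn : (d : ℝ) - τ.card - 1 ≠ 0 := by
      have : (τ.card : ℝ) + 3 ≤ d + 1 := by exact_mod_cast hcard
      linarith
    simp only [ht, sum_triangleWeight, mul_assoc, ← Finset.mul_sum] at key
    simp only [mul_assoc]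
    refine key.trans_eq ?_
    rw [mul_pow, sq, mul_assoc, mul_div_mul_left _ _ hn]
    ring
  · have h0 : K.faceWeight (insert x τ) = 0 :=
      le_antisymm (not_lt.1 fun h => hface (K.faceWeight_pos_iff.1 h)) (K.faceWeight_nonneg _)
    have he (y : V) : K.edgeWeight τ x y = 0 := by
      have h : ∑ y, K.edgeWeight τ x y = 0 := by
        rw [sum_edgeWeight, vertexWeight, if_neg hx, h0, mul_zero]
      exact (Finset.sum_eq_zero_iff_of_nonneg fun y _ => K.edgeWeight_nonneg τ x y).1 h y
        (Finset.mem_univ y)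
    have ht (y z : V) : K.triangleWeight τ x y z = 0 := by
      have h : ∑ z, K.triangleWeight τ x y z = 0 := by rw [sum_triangleWeight, he, mul_zero]
      refine (Finset.sum_eq_zero_iff_of_nonneg fun z _ => ?_).1 h z (Finset.mem_univ z)
      rw [triangleWeight, if_neg hx]
      exact K.edgeWeight_nonneg _ _ _
    simp [he, ht]

/-- One step of the trickling down: an expansion bound `γ` in the links of the vertices of the link
of `τ` gives the bound `γ / (1 - γ)` in the link of `τ`. -/
theorem TotallyConnected.lambda2_walkMatrix_le {K : WeightedComplex V d}
    (hK : K.TotallyConnected) {τ : Finset V} (hτ : K.IsFace τ) (hcard : τ.card + 3 ≤ d + 1)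
    {γ : ℝ} (hγ0 : 0 ≤ γ) (hγ1 : γ < 1)
    (hγ : ∀ x, x ∉ τ → K.IsFace (insert x τ) → lambda2 (K.walkMatrix (insert x τ)) ≤ γ) :
    lambda2 (K.walkMatrix τ) ≤ γ / (1 - γ) := by
  have hc : 0 ≤ γ / (1 - γ) := div_nonneg hγ0 (by linarith)
  refine lambda2_le hc fun μ hμ h1 => ?_
  rcases le_or_gt μ 0 with hμ0 | hμ0
  · exact hμ0.trans hc
  rw [K.walkMatrix_eq hτ, Matrix.mem_spectrum_iff_exists_mulVec] at hμ
  obtain ⟨f, hf0, hf⟩ := hμ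
  set W := K.edgeWeight τ with hW
  set D : V → ℝ := fun x => ∑ z, W x z with hD
  have hWnn (x y : V) : 0 ≤ W x y := K.edgeWeight_nonneg τ x y
  have hDnn (x : V) : 0 ≤ D x := Finset.sum_nonneg fun z _ => hWnn x z
  have hP (x : V) : (∑ y, W x y * f y) / D x = μ * f x := by
    have : ∑ y, W x y / D x * f y = μ * f x := congrFun hf x
    rw [← this, Finset.sum_div]
    exact Finset.sum_congr rfl fun y _ => by ring
  have heig (x : V) : ∑ y, W x y * f y = μ * (D x * f x) := by
    by_cases hx : D x = 0
    · have hWx (y : V) : W x y = 0 :=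
        (Finset.sum_eq_zero_iff_of_nonneg fun z _ => hWnn x z).1 hx y (Finset.mem_univ y)
      simp [hWx, hx]
    · rw [(div_eq_iff hx).1 (hP x)]; ring
  set N := ∑ x, D x * f x ^ 2 with hN
  have hNpos : 0 < N := by
    obtain ⟨a, ha⟩ := Function.ne_iff.1 hf0
    have hDa : D a ≠ 0 := by
      intro h
      have := hP a
      rw [h, div_zero] at this
      exact mul_ne_zero hμ0.ne' ha this.symm
    exact Finset.sum_pos' (fun x _ => mul_nonneg (hDnn x) (sq_nonneg _))
      ⟨a, Finset.mem_univ a, mul_pos ((hDnn a).lt_of_ne' hDa) (sq_pos_of_ne_zero ha)⟩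
  set n : ℝ := (d : ℝ) - τ.card - 1 with hn
  have hnpos : 0 < n := by
    have : (τ.card : ℝ) + 3 ≤ d + 1 := by exact_mod_cast hcard
    linarith
  have hform : ∑ x, ∑ y, ∑ z, K.triangleWeight τ x y z * f y * f z = n * (μ * N) := by
    calc _ = ∑ y, ∑ z, (∑ x, K.triangleWeight τ y z x) * f y * f z := by
          rw [Finset.sum_comm]
          refine Finset.sum_congr rfl fun y _ => ?_
          rw [Finset.sum_comm]
          refine Finset.sum_congr rfl fun z _ => ?_
          rw [Finset.sum_mul, Finset.sum_mul]
          exact Finset.sum_congr rfl fun x _ => by rw [triangleWeight_rotate]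
      _ = ∑ y, n * (f y * ∑ z, W y z * f z) := by
          refine Finset.sum_congr rfl fun y _ => ?_
          rw [Finset.mul_sum, Finset.mul_sum]
          exact Finset.sum_congr rfl fun z _ => by rw [sum_triangleWeight]; ring
      _ = n * (μ * N) := by
          rw [hN, Finset.mul_sum, Finset.mul_sum]
          exact Finset.sum_congr rfl fun y _ => by rw [heig]; ring
  have hsq : ∑ x, ∑ y, W x y * f y ^ 2 = N := by
    rw [Finset.sum_comm]
    refine Finset.sum_congr rfl fun y _ => ?_
    rw [← Finset.sum_mul]
    congr 1
    exact Finset.sum_congr rfl fun x _ => K.edgeWeight_comm τ x y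
  have hmean : ∑ x, (∑ y, W x y * f y) ^ 2 / D x = μ ^ 2 * N := by
    rw [hN, Finset.mul_sum]
    refine Finset.sum_congr rfl fun x _ => ?_
    rw [sq, mul_div_assoc, hP, heig]
    ring
  have hsum := Finset.sum_le_sum fun x (_ : x ∈ Finset.univ) =>
    hK.sum_triangleWeight_le hcard hγ f x
  rw [hform, ← Finset.mul_sum, Finset.sum_add_distrib, ← Finset.mul_sum, ← Finset.mul_sum,
    hsq, hmean] at hsum
  have h2 : μ * N ≤ (γ + (1 - γ) * μ ^ 2) * N := by
    linarith [le_of_mul_le_mul_left hsum hnpos]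
  have h3 : μ ≤ γ + (1 - γ) * μ ^ 2 := le_of_mul_le_mul_right h2 hNpos
  rw [le_div_iff₀ (by linarith)]
  have h4 : 0 ≤ (1 - μ) * (γ - μ * (1 - γ)) := by linarith
  linarith [nonneg_of_mul_nonneg_right h4 (by linarith)]

end WeightedComplex

open WeightedComplex in
/-- **Trickle down theorem.** If every link of a face of co-dimension 2 of a totally connected
pure `d`-dimensional weighted complex is a `(1-δ)/d`-spectral expander, then every link of a
face of co-dimension `k` (for `2 ≤ k ≤ d`) is a `(1-δ)/(d-(k-2)(1-δ))`-spectral expander, and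
consequently a `(1-δ)/(dδ)`-spectral expander. -/
theorem trickle_down
    {V : Type*} [Fintype V] [DecidableEq V] {d : ℕ} (hd : 2 ≤ d)
    (K : WeightedComplex V d) (hconn : K.TotallyConnected)
    (δ : ℝ) (hδ0 : 0 < δ) (hδ1 : δ ≤ 1)
    (hγ2 : ∀ τ : Finset V, K.IsFace τ → τ.card = d - 1 →
      lambda2 (K.walkMatrix τ) ≤ (1 - δ) / (d : ℝ)) :
    ∀ k : ℕ, 2 ≤ k → k ≤ d →
      ∀ τ : Finset V, K.IsFace τ → τ.card = d + 1 - k →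
        lambda2 (K.walkMatrix τ) ≤ (1 - δ) / ((d : ℝ) - ((k : ℝ) - 2) * (1 - δ)) ∧
        lambda2 (K.walkMatrix τ) ≤ (1 - δ) / ((d : ℝ) * δ) := by
  have hdR : (2 : ℝ) ≤ d := by exact_mod_cast hd
  have hden {k : ℕ} (hk2 : 2 ≤ k) (hkd : k ≤ d) :
      (d : ℝ) * δ ≤ (d : ℝ) - ((k : ℝ) - 2) * (1 - δ) ∧
        1 - δ < (d : ℝ) - ((k : ℝ) - 2) * (1 - δ) := by
    have hk2R : (2 : ℝ) ≤ k := by exact_mod_cast hk2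
    have hkdR : (k : ℝ) ≤ d := by exact_mod_cast hkd
    constructor <;> nlinarith [mul_nonneg (sub_nonneg.2 hkdR) (sub_nonneg.2 hδ1)]
  have main : ∀ k : ℕ, 2 ≤ k → k ≤ d → ∀ τ : Finset V, K.IsFace τ → τ.card = d + 1 - k →
      lambda2 (K.walkMatrix τ) ≤ (1 - δ) / ((d : ℝ) - ((k : ℝ) - 2) * (1 - δ)) := by
    intro k hk2
    induction k, hk2 using Nat.le_induction with
    | base =>
      intro _ τ hτ hcard
      simpa using hγ2 τ hτ (by omega)
    | succ k hk2 ih =>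
      intro hkd τ hτ hcard
      have hlt := (hden hk2 (by omega)).2
      have hlt' := (hden (k := k + 1) (by omega) hkd).2
      set q := (d : ℝ) - ((k : ℝ) - 2) * (1 - δ) with hq
      have hq0 : 0 < q := by linarith
      have hstep := hconn.lambda2_walkMatrix_le hτ (by omega) (γ := (1 - δ) / q)
        (div_nonneg (by linarith) hq0.le) ((div_lt_one hq0).2 hlt) fun x hx hface =>
          ih (by omega) _ hface (by rw [Finset.card_insert_of_notMem hx]; omega)
      refine hstep.trans_eq ?_
      have hq1 : q - (1 - δ) ≠ 0 := by linarith
      rw [show (d : ℝ) - (((k + 1 : ℕ) : ℝ) - 2) * (1 - δ) = q - (1 - δ) by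
        rw [hq]; push_cast; ring, one_sub_div hq0.ne', div_div_div_cancel_right₀ hq0.ne']
  intro k hk2 hkd τ hτ hcard
  have h := main k hk2 hkd τ hτ hcard
  exact ⟨h, h.trans (div_le_div_of_nonneg_left (by linarith) (by positivity) (hden hk2 hkd).1)⟩
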